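/- arXiv:2412.01139 — 2 statements merged into one kernel-verified Lean document; each statement's English description precedes it below -/
import Mathlib

section
/- Suppose the noise density f is piecewise monotone and its largest global maximizer x_m exists and is a mode of f. Then for every prize schedule v ∈ 𝒱 there exists a point m* ≥ x_m which is a mode of f such that g(m*; v) ≥ g(t; v) for every t ∈ ℝ. (That is, for any prize schedule, the marginal benefit of effort is maximized by a threshold located at a mode of the noise density weakly above its global mode.) -/
open MeasureTheory

/-- The CDF associated with a density `f`. -/
noncomputable def Fcdf (f : ℝ → ℝ) (x : ℝ) : ℝ := ∫ u in Set.Iic x, f u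

/-- `F_{(j:m)}`, the CDF of the `j`-th smallest of `m` i.i.d. draws (binomial-sum form),
with the convention `F_{(0:m)} ≡ 1`. -/
noncomputable def Fos (f : ℝ → ℝ) (j m : ℕ) (x : ℝ) : ℝ :=
  if j = 0 then 1
  else ∑ k ∈ Finset.Icc j m, (m.choose k : ℝ) * Fcdf f x ^ k * (1 - Fcdf f x) ^ (m - k)

/-- `f_{(j:m)}`, the density of the `j`-th smallest of `m` i.i.d. draws,
with the convention `f_{(0:m)} ≡ 0`. -/
noncomputable def fos (f : ℝ → ℝ) (j m : ℕ) (x : ℝ) : ℝ :=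
  if j = 0 then 0
  else (j : ℝ) * (m.choose j : ℝ) * Fcdf f x ^ (j - 1) * (1 - Fcdf f x) ^ (m - j) * f x

/-- The marginal-benefit coefficient `B_r(t)`. -/
noncomputable def Bcoef (f : ℝ → ℝ) (n r : ℕ) (t : ℝ) : ℝ :=
  f t * Fos f (n - r) (n - 1) t + ∫ x in Set.Ioi t, f x * fos f (n - r) (n - 1) x

/-- The marginal benefit of effort `g(t; v)` with threshold `t` and prize schedule `v`. -/
noncomputable def gmb (f : ℝ → ℝ) (n : ℕ) (v : ℕ → ℝ) (t : ℝ) : ℝ :=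
  ∑ r ∈ Finset.Icc 1 n, Bcoef f n r t * (v r - v (r + 1))

/-- A noise density: nonnegative, bounded, integrating to one, vanishing outside
`[xl, xu]` and continuous there.  The endpoints may be infinite. -/
def IsNoiseDensity (f : ℝ → ℝ) (xl xu : EReal) : Prop :=
  xl < xu ∧ (∀ x, 0 ≤ f x) ∧ (∃ M, ∀ x, f x ≤ M) ∧ (∫ x, f x = 1) ∧
    (∀ x : ℝ, ((x : EReal) < xl ∨ xu < (x : EReal)) → f x = 0) ∧
    ContinuousOn f {x : ℝ | xl ≤ (x : EReal) ∧ (x : EReal) ≤ xu}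

/-- A prize schedule `v = (v 1, …, v n)`: nonincreasing, nonnegative, summing to one,
with the convention `v (n+1) = 0`. -/
def IsPrizeSchedule (n : ℕ) (v : ℕ → ℝ) : Prop :=
  (∀ r ∈ Finset.Icc 1 n, 0 ≤ v r) ∧ (∀ r, 1 ≤ r → r < n → v (r + 1) ≤ v r) ∧
    (∑ r ∈ Finset.Icc 1 n, v r = 1) ∧ v (n + 1) = 0

/-- `m` is a mode of `f`. -/
def IsMode (f : ℝ → ℝ) (m : ℝ) : Prop :=
  ∃ a b : ℝ, a < m ∧ m < b ∧ MonotoneOn f (Set.Icc a m) ∧ AntitoneOn f (Set.Icc m b) ∧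
    f a < f m ∧ f b < f m

/-- `f` is piecewise monotone: away from finitely many points it is monotone. -/
def PiecewiseMonotone (f : ℝ → ℝ) : Prop :=
  ∃ s : Finset ℝ, ∀ a b : ℝ, a < b → (∀ c ∈ s, c ∉ Set.Ioo a b) →
    MonotoneOn f (Set.Ioo a b) ∨ AntitoneOn f (Set.Ioo a b)

/-- Monotonicity on an open interval extends to its closure by continuity. -/
lemma MonotoneOn.Icc_of_continuousOn {f : ℝ → ℝ} {a b : ℝ} (hm : MonotoneOn f (Set.Ioo a b))
    (hc : ContinuousOn f (Set.Icc a b)) : MonotoneOn f (Set.Icc a b) := by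
  intro x hx y hy hxy
  rcases hxy.eq_or_lt with rfl | hlt
  · exact le_rfl
  have key : ∀ w ∈ Set.Ioo x y, f x ≤ f w ∧ f w ≤ f y := by
    intro w hw
    have hwI : w ∈ Set.Ioo a b := ⟨hx.1.trans_lt hw.1, hw.2.trans_le hy.2⟩
    constructor
    · refine ContinuousWithinAt.closure_le (s := Set.Ioo x w) (f := f) (g := fun _ => f w) ?_
        ((hc x hx).mono fun z hz => ⟨hx.1.trans hz.1.le, (hz.2.trans hwI.2).le⟩)
        continuousWithinAt_const ?_
      · rw [closure_Ioo hw.1.ne]; exact Set.left_mem_Icc.2 hw.1.le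
      · exact fun z hz => hm ⟨hx.1.trans_lt hz.1, hz.2.trans hwI.2⟩ hwI hz.2.le
    · refine ContinuousWithinAt.closure_le (s := Set.Ioo w y) (f := fun _ => f w) (g := f) ?_
        continuousWithinAt_const
        ((hc y hy).mono fun z hz => ⟨(hwI.1.trans hz.1).le, hz.2.le.trans hy.2⟩) ?_
      · rw [closure_Ioo hw.2.ne]; exact Set.right_mem_Icc.2 hw.2.le
      · exact fun z hz => hm hwI ⟨hwI.1.trans hz.1, hz.2.trans_le hy.2⟩ hz.1.le
  obtain ⟨w, hw⟩ := exists_between hlt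
  exact (key w hw).1.trans (key w hw).2

lemma AntitoneOn.Icc_of_continuousOn {f : ℝ → ℝ} {a b : ℝ} (hm : AntitoneOn f (Set.Ioo a b))
    (hc : ContinuousOn f (Set.Icc a b)) : AntitoneOn f (Set.Icc a b) := by
  simpa using (MonotoneOn.Icc_of_continuousOn hm.neg hc.neg).neg

lemma Finset.exists_Ioo_right_disjoint (s : Finset ℝ) {p B : ℝ} (h : p < B) :
    ∃ b, p < b ∧ b ≤ B ∧ ∀ c ∈ s, c ∉ Set.Ioo p b := by
  induction s using Finset.induction_on with
  | empty => exact ⟨B, h, le_rfl, by simp⟩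
  | insert a s _ ih =>
    obtain ⟨b, hpb, hbB, hb⟩ := ih
    by_cases hpa : p < a
    · refine ⟨min a b, lt_min hpa hpb, (min_le_right _ _).trans hbB, ?_⟩
      intro c hc hcI
      rcases Finset.mem_insert.1 hc with rfl | hc
      · exact absurd (hcI.2.trans_le (min_le_left _ _)) (lt_irrefl _)
      · exact hb c hc ⟨hcI.1, hcI.2.trans_le (min_le_right _ _)⟩
    · refine ⟨b, hpb, hbB, ?_⟩
      intro c hc hcI
      rcases Finset.mem_insert.1 hc with rfl | hc
      · exact hpa hcI.1
      · exact hb c hc hcI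

lemma Finset.exists_Ioo_left_disjoint (s : Finset ℝ) {p A : ℝ} (h : A < p) :
    ∃ a, A < a ∧ a < p ∧ ∀ c ∈ s, c ∉ Set.Ioo a p := by
  obtain ⟨A', hA', hA'p⟩ := _root_.exists_between h
  obtain ⟨b, h1, h2, h3⟩ :=
    Finset.exists_Ioo_right_disjoint (s.image Neg.neg) (neg_lt_neg hA'p)
  refine ⟨-b, by linarith, by linarith, fun c hc hcI => ?_⟩
  exact h3 (-c) (Finset.mem_image_of_mem _ hc) ⟨by linarith [hcI.2], by linarith [hcI.1]⟩

/-- Right of any point at which it is continuous from the right, a piecewise monotone function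
is monotone on some closed interval. -/
lemma PiecewiseMonotone.exists_right {f : ℝ → ℝ} (hpm : PiecewiseMonotone f) {p B : ℝ}
    (h : p < B) (hc : ContinuousOn f (Set.Icc p B)) :
    ∃ b, p < b ∧ b ≤ B ∧ (MonotoneOn f (Set.Icc p b) ∨ AntitoneOn f (Set.Icc p b)) := by
  obtain ⟨s, hs⟩ := hpm
  obtain ⟨b, hpb, hbB, hb⟩ := s.exists_Ioo_right_disjoint h
  have hc' := hc.mono (Set.Icc_subset_Icc_right hbB)
  exact ⟨b, hpb, hbB, (hs p b hpb hb).imp (fun hm => hm.Icc_of_continuousOn hc')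
    fun hm => hm.Icc_of_continuousOn hc'⟩

lemma PiecewiseMonotone.exists_left {f : ℝ → ℝ} (hpm : PiecewiseMonotone f) {p A : ℝ}
    (h : A < p) (hc : ContinuousOn f (Set.Icc A p)) :
    ∃ a, A < a ∧ a < p ∧ (MonotoneOn f (Set.Icc a p) ∨ AntitoneOn f (Set.Icc a p)) := by
  obtain ⟨s, hs⟩ := hpm
  obtain ⟨a, hAa, hap, ha⟩ := s.exists_Ioo_left_disjoint h
  have hc' := hc.mono (Set.Icc_subset_Icc_left hAa.le)
  exact ⟨a, hAa, hap, (hs a p hap ha).imp (fun hm => hm.Icc_of_continuousOn hc')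
    fun hm => hm.Icc_of_continuousOn hc'⟩

/-- If `g` moves with `f` (in the sense of the Stieltjes identity `dg = G df`), then `g` is
maximized at a mode of `f` weakly above the largest global maximizer `xm`. -/
lemma exists_mode_isMax {f g G : ℝ → ℝ} {xm E : ℝ} (hE : xm ≤ E) (hpm : PiecewiseMonotone f)
    (hf0 : ∀ x, 0 ≤ f x) (hfc : ContinuousOn f (Set.Icc xm E)) (hfE : AntitoneOn f (Set.Ici E))
    (hEpos : 0 < f E → ∃ b, E < b ∧ f b < f E)
    (hmax : ∀ x, f x ≤ f xm) (hlargest : ∀ x, f x = f xm → x ≤ xm) (hmode : IsMode f xm)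
    (hgc : ContinuousOn g (Set.Icc xm E)) (hG : ∀ x, 0 ≤ G x)
    (hGpos : ∀ x ∈ Set.Ioc xm E, 0 < G x)
    (hup : ∀ s t, s ≤ t → (∀ x ∈ Set.Icc s t, f x ≤ f t) → g s + (f t - f s) * G s ≤ g t)
    (hdown : ∀ s t, s ≤ t → (∀ x ∈ Set.Icc s t, f t ≤ f x) → g t + (f s - f t) * G s ≤ g s) :
    ∃ m : ℝ, xm ≤ m ∧ IsMode f m ∧ ∀ t : ℝ, g t ≤ g m := by
  have hup' : ∀ s t, s ≤ t → (∀ x ∈ Set.Icc s t, f x ≤ f t) → g s ≤ g t := fun s t hst h =>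
    (le_add_of_nonneg_right (mul_nonneg (sub_nonneg.2 (h s ⟨le_rfl, hst⟩)) (hG s))).trans
      (hup s t hst h)
  have hdown' : ∀ s t, s ≤ t → (∀ x ∈ Set.Icc s t, f t ≤ f x) → g t ≤ g s := fun s t hst h =>
    (le_add_of_nonneg_right (mul_nonneg (sub_nonneg.2 (h s ⟨le_rfl, hst⟩)) (hG s))).trans
      (hdown s t hst h)
  obtain ⟨p₀, hp₀, hp₀max⟩ :=
    isCompact_Icc.exists_isMaxOn (Set.nonempty_Icc.2 hE) hgc
  have hglob : ∀ t, g t ≤ g p₀ := by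
    intro t
    rcases le_total t xm with h | h
    · exact (hup' t xm h fun x _ => hmax x).trans (hp₀max ⟨le_rfl, hE⟩)
    rcases le_total t E with h' | h'
    · exact hp₀max ⟨h, h'⟩
    · exact (hdown' E t h' fun x hx => hfE hx.1 h' hx.2).trans (hp₀max ⟨hE, le_rfl⟩)
  -- the rightmost maximizer of `g` on `[xm, E]`
  have hAcomp : IsCompact (Set.Icc xm E ∩ g ⁻¹' {g p₀}) :=
    isCompact_Icc.of_isClosed_subset
      (hgc.preimage_isClosed_of_isClosed isClosed_Icc isClosed_singleton) Set.inter_subset_left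
  obtain ⟨p, ⟨hp, hgp⟩, hpub⟩ := hAcomp.exists_isGreatest ⟨p₀, hp₀, rfl⟩
  replace hgp : g p = g p₀ := hgp
  have hpmax : ∀ t, g t ≤ g p := fun t => hgp ▸ hglob t
  have hright : ∀ d ∈ Set.Icc xm E, p < d → g d < g p := by
    intro d hd hpd
    refine lt_of_le_of_ne (hpmax d) fun h => ?_
    exact absurd (hpub ⟨hd, h.trans hgp⟩) (not_le.2 hpd)
  by_cases hpxm : p = xm
  · exact ⟨xm, le_rfl, hmode, hpxm ▸ hpmax⟩
  have hxmp : xm < p := lt_of_le_of_ne hp.1 (Ne.symm hpxm)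
  -- the left end of the plateau of `f` ending at `p`
  set S : Set ℝ := {t | t ∈ Set.Icc xm p ∧ ∀ x ∈ Set.Icc t p, f x = f p} with hS
  have hpS : p ∈ S := ⟨⟨hp.1, le_rfl⟩, fun x hx => by rw [le_antisymm hx.2 hx.1]⟩
  have hSbdd : BddBelow S := ⟨xm, fun t ht => ht.1.1⟩
  set q := sInf S with hq
  have hxq : xm ≤ q := le_csInf ⟨p, hpS⟩ fun t ht => ht.1.1
  have hqp : q ≤ p := csInf_le hSbdd hpS
  have hqI : ∀ x ∈ Set.Ioc q p, f x = f p := by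
    intro x hx
    obtain ⟨t, htS, htx⟩ := exists_lt_of_csInf_lt ⟨p, hpS⟩ hx.1
    exact htS.2 x ⟨htx.le, hx.2⟩
  have hfq : f q = f p := by
    rcases hqp.eq_or_lt with h | h
    · rw [h]
    have hcw : ContinuousWithinAt f (Set.Ioc q p) q :=
      (hfc q ⟨hxq, hqp.trans hp.2⟩).mono fun z hz => ⟨hxq.trans hz.1.le, hz.2.trans hp.2⟩
    have hcl : q ∈ closure (Set.Ioc q p) := by
      rw [closure_Ioc h.ne]; exact Set.left_mem_Icc.2 h.le
    exact le_antisymm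
      (hcw.closure_le hcl continuousWithinAt_const fun y hy => (hqI y hy).le)
      (ContinuousWithinAt.closure_le hcl continuousWithinAt_const hcw fun y hy => (hqI y hy).ge)
  have hqI' : ∀ x ∈ Set.Icc q p, f x = f p := by
    intro x hx
    rcases hx.1.eq_or_lt with h | h
    · rw [← h, hfq]
    · exact hqI x ⟨h, hx.2⟩
  have hxq' : xm < q := by
    refine lt_of_le_of_ne hxq fun h => ?_
    exact absurd (hlargest p (by rw [← hfq, ← h])) (not_le.2 hxmp)
  have hgq : ∀ t, g t ≤ g q := fun t => (hpmax t).trans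
    (hdown' q p hqp fun x hx => (hqI' x hx).ge)
  obtain ⟨c, hxc, hcq, hc⟩ := hpm.exists_left hxq'
    (hfc.mono (Set.Icc_subset_Icc_right (hqp.trans hp.2)))
  have hconst : ¬ ∀ x ∈ Set.Icc c q, f x = f q := by
    intro h
    have : c ∈ S := ⟨⟨hxc.le, hcq.le.trans hqp⟩, fun x hx => by
      rcases le_total x q with hx' | hx'
      · rw [h x ⟨hx.1, hx'⟩, hfq]
      · exact hqI' x ⟨hx', hx.2⟩⟩
    exact absurd (csInf_le hSbdd this) (not_le.2 hcq)
  have hcI : c ∈ Set.Icc c q := ⟨le_rfl, hcq.le⟩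
  have hqI2 : q ∈ Set.Icc c q := ⟨hcq.le, le_rfl⟩
  have hcm : MonotoneOn f (Set.Icc c q) := by
    refine hc.resolve_right fun ha => hconst ?_
    have h1 := hdown c q hcq.le fun x hx => ha hx hqI2 hx.2
    have h2 := hGpos c ⟨hxc, hcq.le.trans (hqp.trans hp.2)⟩
    have h3 : f c ≤ f q := by
      by_contra! h
      nlinarith [hgq c, mul_pos (sub_pos.2 h) h2]
    exact fun x hx => le_antisymm ((ha hcI hx hx.1).trans h3) (ha hx hqI2 hx.2)
  have hcstrict : f c < f q := by
    refine lt_of_le_of_ne (hcm hcI hqI2 hcq.le) fun h => hconst fun x hx => ?_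
    exact le_antisymm (hcm hx hqI2 hx.2) (h ▸ hcm hcI hx hx.1)
  have hmono : MonotoneOn f (Set.Icc c p) := by
    intro x hx y hy hxy
    rcases le_total y q with hyq | hyq
    · exact hcm ⟨hx.1, hxy.trans hyq⟩ ⟨hy.1, hyq⟩ hxy
    · rw [hqI' y ⟨hyq, hy.2⟩, ← hfq]
      rcases le_total x q with hxq | hxq
      · exact hcm ⟨hx.1, hxq⟩ hqI2 hxq
      · rw [hqI' x ⟨hxq, hx.2⟩, hfq]
  obtain ⟨d, hpd, hanti, hd⟩ : ∃ d, p < d ∧ AntitoneOn f (Set.Icc p d) ∧ f d < f p := by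
    rcases hp.2.eq_or_lt with h | h
    · obtain ⟨b, hb, hb'⟩ := hEpos (h ▸ hfq ▸ (hf0 c).trans_lt hcstrict)
      rw [h]
      exact ⟨b, hb, hfE.mono fun x hx => hx.1, hb'⟩
    · obtain ⟨d, hpd, hdE, hd⟩ := hpm.exists_right h (hfc.mono (Set.Icc_subset_Icc_left hp.1))
      have hlt := hright d ⟨hp.1.trans hpd.le, hdE⟩ hpd
      have hdI : d ∈ Set.Icc p d := ⟨hpd.le, le_rfl⟩
      have hpI : p ∈ Set.Icc p d := ⟨le_rfl, hpd.le⟩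
      have ha : AntitoneOn f (Set.Icc p d) := by
        refine hd.resolve_left fun hm => ?_
        exact absurd (hup' p d hpd.le fun x hx => hm hx hdI hx.2) (not_le.2 hlt)
      refine ⟨d, hpd, ha, lt_of_le_of_ne (ha hpI hdI hpd.le) fun he => ?_⟩
      exact absurd (hup' p d hpd.le fun x hx => he ▸ ha hpI hx hx.1) (not_le.2 hlt)
  exact ⟨p, hp.1, ⟨c, d, hcq.trans_le hqp, hpd, hmono, hanti, hfq ▸ hcstrict, hd⟩, hpmax⟩

/-- The marginal benefit attached to a density `f`, a distribution `G` and its density `h`. -/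
noncomputable def stieltjesBenefit (f G h : ℝ → ℝ) (t : ℝ) : ℝ :=
  f t * G t + ∫ x in Set.Ioi t, f x * h x

section StieltjesBenefit

variable {f G h : ℝ → ℝ}

lemma stieltjesBenefit_le_of_le_right (hh : Integrable h) (hfh : Integrable fun x => f x * h x)
    (hG : ∀ s t, ∫ x in s..t, h x = G t - G s) (h0 : ∀ x, 0 ≤ h x) {s t : ℝ} (hst : s ≤ t)
    (hle : ∀ x ∈ Set.Icc s t, f x ≤ f t) :
    stieltjesBenefit f G h s + (f t - f s) * G s ≤ stieltjesBenefit f G h t := by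
  have h1 := intervalIntegral.integral_Ioi_sub_Ioi (μ := volume) (a := s) hfh.integrableOn hst
  have h2 : ∫ x in s..t, f x * h x ≤ ∫ x in s..t, f t * h x :=
    intervalIntegral.integral_mono_on hst hfh.intervalIntegrable
      (hh.const_mul _).intervalIntegrable
      fun x hx => mul_le_mul_of_nonneg_right (hle x hx) (h0 x)
  rw [intervalIntegral.integral_const_mul, hG] at h2
  unfold stieltjesBenefit
  linarith

lemma stieltjesBenefit_le_of_le_left (hh : Integrable h) (hfh : Integrable fun x => f x * h x)
    (hG : ∀ s t, ∫ x in s..t, h x = G t - G s) (h0 : ∀ x, 0 ≤ h x) {s t : ℝ} (hst : s ≤ t)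
    (hle : ∀ x ∈ Set.Icc s t, f t ≤ f x) :
    stieltjesBenefit f G h t + (f s - f t) * G s ≤ stieltjesBenefit f G h s := by
  have h1 := intervalIntegral.integral_Ioi_sub_Ioi (μ := volume) (a := s) hfh.integrableOn hst
  have h2 : ∫ x in s..t, f t * h x ≤ ∫ x in s..t, f x * h x :=
    intervalIntegral.integral_mono_on hst (hh.const_mul _).intervalIntegrable
      hfh.intervalIntegrable
      fun x hx => mul_le_mul_of_nonneg_right (hle x hx) (h0 x)
  rw [intervalIntegral.integral_const_mul, hG] at h2
  unfold stieltjesBenefit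
  linarith

lemma continuousOn_stieltjesBenefit {s : Set ℝ} (hfh : Integrable fun x => f x * h x)
    (hf : ContinuousOn f s) (hG : ContinuousOn G s) :
    ContinuousOn (stieltjesBenefit f G h) s := by
  have h1 : ∀ t, ∫ x in Set.Ioi t, f x * h x
      = (∫ x in Set.Ioi 0, f x * h x) - ∫ x in (0 : ℝ)..t, f x * h x := by
    intro t
    rw [← intervalIntegral.integral_Ioi_sub_Ioi' hfh.integrableOn hfh.integrableOn]
    ring
  have h2 : Continuous fun t => ∫ x in Set.Ioi t, f x * h x := by
    rw [funext h1]
    exact continuous_const.sub (hfh.continuous_primitive 0)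
  exact (hf.mul hG).add h2.continuousOn

end StieltjesBenefit

/-- `F_{(j:m)}` as a function of the CDF value `y`. -/
noncomputable def orderStatCdf (j m : ℕ) (y : ℝ) : ℝ :=
  if j = 0 then 1
  else ∑ k ∈ Finset.Icc j m, (m.choose k : ℝ) * y ^ k * (1 - y) ^ (m - k)

/-- The derivative of `orderStatCdf`. -/
noncomputable def orderStatPdf (j m : ℕ) (y : ℝ) : ℝ :=
  if j = 0 then 0
  else (j : ℝ) * (m.choose j : ℝ) * y ^ (j - 1) * (1 - y) ^ (m - j)

lemma hasDerivAt_orderStatCdf {j m : ℕ} (hjm : j ≤ m) (y : ℝ) :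
    HasDerivAt (orderStatCdf j m) (orderStatPdf j m y) y := by
  unfold orderStatCdf orderStatPdf
  split_ifs with hj
  · exact hasDerivAt_const y 1
  set D : ℕ → ℝ := fun k => (k : ℝ) * (m.choose k : ℝ) * y ^ (k - 1) * (1 - y) ^ (m - k) with hD
  have hterm : ∀ k ∈ Finset.Icc j m,
      HasDerivAt (fun z : ℝ => (m.choose k : ℝ) * z ^ k * (1 - z) ^ (m - k))
        (D k - D (k + 1)) y := by
    intro k hk
    have hkm := (Finset.mem_Icc.1 hk).2
    have h1 := ((hasDerivAt_pow k y).const_mul (m.choose k : ℝ)).mul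
      (((hasDerivAt_id y).const_sub 1).pow (m - k))
    refine h1.congr_deriv ?_
    have h2 : (m.choose (k + 1) : ℝ) * (k + 1) = m.choose k * ((m - k : ℕ) : ℝ) := by
      exact_mod_cast Nat.choose_succ_right_eq m k
    have h3 : ((k + 1 : ℕ) : ℝ) * (m.choose (k + 1) : ℝ) = m.choose k * ((m - k : ℕ) : ℝ) := by
      rw [← h2]; push_cast; ring
    have h4 : m - (k + 1) = m - k - 1 := by omega
    simp only [hD, h3, h4, Nat.add_sub_cancel, id]
    simp
    ring
  have hsum : HasDerivAt (fun z : ℝ => ∑ k ∈ Finset.Icc j m,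
      (m.choose k : ℝ) * z ^ k * (1 - z) ^ (m - k))
      (∑ k ∈ Finset.Icc j m, (D k - D (k + 1))) y := HasDerivAt.fun_sum hterm
  refine hsum.congr_deriv ?_
  have h5 : ∑ k ∈ Finset.Icc j m, (D k - D (k + 1)) = -∑ k ∈ Finset.Ico j (m + 1),
      (D (k + 1) - D k) := by
    rw [← Finset.sum_neg_distrib]
    exact Finset.sum_congr (by ext; simp) fun k _ => by ring
  rw [h5, Finset.sum_Ico_sub D (by omega)]
  simp [hD]

lemma continuous_orderStatPdf (j m : ℕ) : Continuous (orderStatPdf j m) := by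
  unfold orderStatPdf
  split_ifs <;> fun_prop

lemma orderStatPdf_nonneg (j m : ℕ) {y : ℝ} (hy : y ∈ Set.Icc (0 : ℝ) 1) :
    0 ≤ orderStatPdf j m y := by
  have h0 := hy.1
  have h1 := sub_nonneg.2 hy.2
  unfold orderStatPdf
  split_ifs <;> positivity

lemma pow_le_orderStatCdf {j m : ℕ} (hjm : j ≤ m) {y : ℝ} (hy : y ∈ Set.Icc (0 : ℝ) 1) :
    y ^ m ≤ orderStatCdf j m y := by
  have h0 := hy.1
  have h1 := sub_nonneg.2 hy.2
  unfold orderStatCdf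
  split_ifs
  · exact pow_le_one₀ hy.1 hy.2
  · have := Finset.single_le_sum (s := Finset.Icc j m)
      (f := fun k => (m.choose k : ℝ) * y ^ k * (1 - y) ^ (m - k))
      (fun k _ => by positivity) (Finset.mem_Icc.2 ⟨hjm, le_rfl⟩)
    simpa using this

/-- The prize-weighted combination of the distributions `F_{(n-r:n-1)}`. -/
noncomputable def prizeCdf (n : ℕ) (v : ℕ → ℝ) (y : ℝ) : ℝ :=
  ∑ r ∈ Finset.Icc 1 n, orderStatCdf (n - r) (n - 1) y * (v r - v (r + 1))

/-- The derivative of `prizeCdf`. -/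
noncomputable def prizePdf (n : ℕ) (v : ℕ → ℝ) (y : ℝ) : ℝ :=
  ∑ r ∈ Finset.Icc 1 n, orderStatPdf (n - r) (n - 1) y * (v r - v (r + 1))

lemma hasDerivAt_prizeCdf (n : ℕ) (v : ℕ → ℝ) (y : ℝ) :
    HasDerivAt (prizeCdf n v) (prizePdf n v y) y :=
  HasDerivAt.fun_sum fun r hr => (hasDerivAt_orderStatCdf
    (by have := Finset.mem_Icc.1 hr; omega) y).mul_const _

lemma continuous_prizePdf (n : ℕ) (v : ℕ → ℝ) : Continuous (prizePdf n v) :=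
  continuous_finsetSum _ fun _ _ => (continuous_orderStatPdf _ _).mul continuous_const

lemma IsPrizeSchedule.sub_nonneg {n : ℕ} {v : ℕ → ℝ} (hv : IsPrizeSchedule n v) {r : ℕ}
    (hr : r ∈ Finset.Icc 1 n) : 0 ≤ v r - v (r + 1) := by
  obtain ⟨h1, h2, -, h4⟩ := hv
  have hr' := Finset.mem_Icc.1 hr
  rcases hr'.2.eq_or_lt with rfl | h
  · simpa [h4] using h1 r hr
  · linarith [h2 r hr'.1 h]

lemma IsPrizeSchedule.first_pos {n : ℕ} {v : ℕ → ℝ} (hv : IsPrizeSchedule n v) : 0 < v 1 := by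
  by_contra! h
  have hle : ∀ r, 1 ≤ r → r ≤ n → v r ≤ 0 := by
    intro r hr
    induction r, hr using Nat.le_induction with
    | base => exact fun _ => h
    | succ k hk ih => exact fun hkn => (hv.2.1 k hk hkn).trans (ih (by omega))
  have := Finset.sum_nonpos (s := Finset.Icc 1 n) (f := v) fun r hr =>
    hle r (Finset.mem_Icc.1 hr).1 (Finset.mem_Icc.1 hr).2
  linarith [hv.2.2.1]

lemma prizePdf_nonneg {n : ℕ} {v : ℕ → ℝ} (hv : IsPrizeSchedule n v) {y : ℝ}
    (hy : y ∈ Set.Icc (0 : ℝ) 1) : 0 ≤ prizePdf n v y :=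
  Finset.sum_nonneg fun _ hr => mul_nonneg (orderStatPdf_nonneg _ _ hy) (hv.sub_nonneg hr)

lemma pow_mul_le_prizeCdf {n : ℕ} {v : ℕ → ℝ} (hv : IsPrizeSchedule n v) {y : ℝ}
    (hy : y ∈ Set.Icc (0 : ℝ) 1) : y ^ (n - 1) * v 1 ≤ prizeCdf n v y := by
  have h1 : ∑ r ∈ Finset.Icc 1 n, (v r - v (r + 1)) = v 1 := by
    have h5 : ∑ k ∈ Finset.Icc 1 n, (v k - v (k + 1)) = -∑ k ∈ Finset.Ico 1 (n + 1),
        (v (k + 1) - v k) := by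
      rw [← Finset.sum_neg_distrib]
      exact Finset.sum_congr (by ext; simp) fun k _ => by ring
    rw [h5, Finset.sum_Ico_sub v (by omega), hv.2.2.2]
    ring
  rw [← h1, Finset.mul_sum]
  exact Finset.sum_le_sum fun r hr => mul_le_mul_of_nonneg_right
    (pow_le_orderStatCdf (by have := Finset.mem_Icc.1 hr; omega) hy) (hv.sub_nonneg hr)

lemma Fcdf_mem_Icc {f : ℝ → ℝ} (hi : Integrable f) (h0 : ∀ x, 0 ≤ f x) (h1 : ∫ x, f x = 1)
    (x : ℝ) : Fcdf f x ∈ Set.Icc (0 : ℝ) 1 :=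
  ⟨setIntegral_nonneg measurableSet_Iic fun y _ => h0 y,
    h1 ▸ setIntegral_le_integral hi (ae_of_all _ h0)⟩

lemma Fcdf_eq_add {f : ℝ → ℝ} (hi : Integrable f) (a x : ℝ) :
    Fcdf f x = Fcdf f a + ∫ u in a..x, f u := by
  have := intervalIntegral.integral_Iic_sub_Iic (μ := volume) (a := a) (b := x)
    hi.integrableOn hi.integrableOn
  unfold Fcdf
  linarith

lemma continuous_Fcdf {f : ℝ → ℝ} (hi : Integrable f) : Continuous (Fcdf f) := by
  rw [funext (Fcdf_eq_add hi 0)]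
  exact continuous_const.add (hi.continuous_primitive 0)

lemma hasDerivAt_Fcdf {f : ℝ → ℝ} (hi : Integrable f) {x : ℝ} (hx : ContinuousAt f x) :
    HasDerivAt (Fcdf f) (f x) x := by
  rw [funext (Fcdf_eq_add hi 0)]
  exact (intervalIntegral.integral_hasDerivAt_right hi.intervalIntegrable
    hi.aestronglyMeasurable.stronglyMeasurableAtFilter hx).const_add _

lemma IsNoiseDensity.integrable {f : ℝ → ℝ} {xl xu : EReal} (hf : IsNoiseDensity f xl xu) :
    Integrable f :=
  Integrable.of_integral_ne_zero (by rw [hf.2.2.2.1]; exact one_ne_zero)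

lemma IsNoiseDensity.continuousAt {f : ℝ → ℝ} {xl xu : EReal} (hf : IsNoiseDensity f xl xu)
    {x : ℝ} (hl : (x : EReal) ≠ xl) (hu : (x : EReal) ≠ xu) : ContinuousAt f x := by
  obtain ⟨-, -, -, -, hout, hc⟩ := hf
  have hcoe : Continuous fun y : ℝ => (y : EReal) := continuous_coe_real_ereal
  rcases hl.lt_or_gt with h | h
  · have : f =ᶠ[nhds x] fun _ => 0 := by
      filter_upwards [(isOpen_Iio.preimage hcoe).mem_nhds h] with y hy
      exact hout y (Or.inl hy)
    exact continuousAt_const.congr this.symm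
  rcases hu.lt_or_gt with h' | h'
  · refine hc.continuousAt ?_
    filter_upwards [(isOpen_Ioi.preimage hcoe).mem_nhds h,
      (isOpen_Iio.preimage hcoe).mem_nhds h'] with y hy hy'
    exact ⟨le_of_lt hy, le_of_lt hy'⟩
  · have : f =ᶠ[nhds x] fun _ => 0 := by
      filter_upwards [(isOpen_Ioi.preimage hcoe).mem_nhds h'] with y hy
      exact hout y (Or.inr hy)
    exact continuousAt_const.congr this.symm

lemma countable_coe_eq (z : EReal) : {x : ℝ | (x : EReal) = z}.Countable :=
  Set.Subsingleton.countable fun _ hx _ hy => EReal.coe_injective (hx.trans hy.symm)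

lemma integrable_comp_Fcdf_mul {f φ : ℝ → ℝ} (hi : Integrable f) (h0 : ∀ x, 0 ≤ f x)
    (h1 : ∫ x, f x = 1) (hφ : Continuous φ) : Integrable fun x => φ (Fcdf f x) * f x := by
  obtain ⟨C, hC⟩ := isCompact_Icc.exists_bound_of_continuousOn (hφ.continuousOn (s := Set.Icc 0 1))
  exact hi.bdd_mul (hφ.comp (continuous_Fcdf hi)).aestronglyMeasurable
    (ae_of_all _ fun x => hC _ (Fcdf_mem_Icc hi h0 h1 x))

lemma IsNoiseDensity.integrable_mul {f h : ℝ → ℝ} {xl xu : EReal} (hf : IsNoiseDensity f xl xu)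
    (hh : Integrable h) : Integrable fun x => f x * h x := by
  obtain ⟨M, hM⟩ := hf.2.2.1
  exact hh.bdd_mul hf.integrable.aestronglyMeasurable (c := M)
    (ae_of_all _ fun x => by rw [Real.norm_of_nonneg (hf.2.1 x)]; exact hM x)

/-- The fundamental theorem of calculus for a smooth function of the CDF. -/
lemma IsNoiseDensity.integral_comp_Fcdf_mul {f Φ φ : ℝ → ℝ} {xl xu : EReal}
    (hf : IsNoiseDensity f xl xu) (hΦ : ∀ y, HasDerivAt Φ (φ y) y) (hφ : Continuous φ) (s t : ℝ) :
    ∫ x in s..t, φ (Fcdf f x) * f x = Φ (Fcdf f t) - Φ (Fcdf f s) := by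
  have hi := hf.integrable
  have hcount : ({x : ℝ | (x : EReal) = xl} ∪ {x : ℝ | (x : EReal) = xu}).Countable :=
    (countable_coe_eq xl).union (countable_coe_eq xu)
  have hΦc : Continuous Φ := continuous_iff_continuousAt.2 fun y => (hΦ y).continuousAt
  refine MeasureTheory.integral_eq_of_hasDerivAt_off_countable (fun x => Φ (Fcdf f x)) _ hcount
    (hΦc.comp (continuous_Fcdf hi)).continuousOn ?_
    (integrable_comp_Fcdf_mul hi hf.2.1 hf.2.2.2.1 hφ).intervalIntegrable
  intro x hx
  exact (hΦ _).comp x (hasDerivAt_Fcdf hi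
    (hf.continuousAt (fun h => hx.2 (Or.inl h)) fun h => hx.2 (Or.inr h)))

lemma IsNoiseDensity.gmb_eq {f : ℝ → ℝ} {xl xu : EReal} (hf : IsNoiseDensity f xl xu)
    (n : ℕ) (v : ℕ → ℝ) : gmb f n v = stieltjesBenefit f (fun x => prizeCdf n v (Fcdf f x))
      (fun x => prizePdf n v (Fcdf f x) * f x) := by
  funext t
  have hfos : ∀ j m x, fos f j m x = orderStatPdf j m (Fcdf f x) * f x := by
    intro j m x
    unfold fos orderStatPdf
    split_ifs <;> simp
  have hFos : ∀ j m x, Fos f j m x = orderStatCdf j m (Fcdf f x) := fun _ _ _ => rfl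
  have hint : ∫ x in Set.Ioi t, f x * (prizePdf n v (Fcdf f x) * f x) =
      ∑ r ∈ Finset.Icc 1 n, (∫ x in Set.Ioi t,
        f x * (orderStatPdf (n - r) (n - 1) (Fcdf f x) * f x)) * (v r - v (r + 1)) := by
    simp_rw [← integral_mul_const]
    rw [← integral_finsetSum]
    · refine integral_congr_ae (ae_of_all _ fun x => ?_)
      simp only [prizePdf, Finset.sum_mul, Finset.mul_sum]
      exact Finset.sum_congr rfl fun r _ => by ring
    · intro r _
      exact ((hf.integrable_mul (integrable_comp_Fcdf_mul hf.integrable hf.2.1 hf.2.2.2.1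
        (continuous_orderStatPdf _ _))).mul_const _).integrableOn
  simp only [gmb, Bcoef, stieltjesBenefit, hint, hfos, hFos, prizeCdf, Finset.mul_sum,
    ← Finset.sum_add_distrib]
  exact Finset.sum_congr rfl fun r _ => by ring

/-- An integrable nonnegative function is zero where it is monotone up to infinity. -/
lemma eq_zero_of_monotoneOn_Ioi {f : ℝ → ℝ} (hi : Integrable f) (h0 : ∀ x, 0 ≤ f x) {N : ℝ}
    (hm : MonotoneOn f (Set.Ioi N)) {x : ℝ} (hx : N < x) : f x = 0 := by
  by_contra hne
  have hpos : 0 < f x := lt_of_le_of_ne (h0 x) (Ne.symm hne)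
  set c := (∫ u, f u) / f x + 1 with hc
  have hnn : 0 ≤ ∫ u, f u := integral_nonneg h0
  have hc0 : 0 ≤ c := by positivity
  have h1 : ∫ u in x..x + c, f x ≤ ∫ u in x..x + c, f u :=
    intervalIntegral.integral_mono_on (by linarith) intervalIntegrable_const
      hi.intervalIntegrable fun u hu => hm hx (hx.trans_le hu.1) hu.1
  have h2 : ∫ u in x..x + c, f u ≤ ∫ u, f u := by
    rw [intervalIntegral.integral_of_le (by linarith)]
    exact setIntegral_le_integral hi (ae_of_all _ h0)
  rw [intervalIntegral.integral_const, smul_eq_mul] at h1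
  have h3 : c * f x = (∫ u, f u) + f x := by
    rw [hc]; field_simp
  simp only [add_sub_cancel_left] at h1
  linarith

lemma Finset.exists_forall_lt_real (s : Finset ℝ) (a : ℝ) : ∃ N, a < N ∧ ∀ c ∈ s, c < N := by
  obtain ⟨N, hN⟩ := (insert a s).exists_le
  exact ⟨N + 1, by linarith [hN a (Finset.mem_insert_self _ _)],
    fun c hc => by linarith [hN c (Finset.mem_insert_of_mem hc)]⟩

/-- An integrable nonnegative piecewise monotone function is eventually nonincreasing. -/
lemma PiecewiseMonotone.exists_antitoneOn_Ici {f : ℝ → ℝ} (hpm : PiecewiseMonotone f)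
    (hi : Integrable f) (h0 : ∀ x, 0 ≤ f x) (a : ℝ) : ∃ N, a ≤ N ∧ AntitoneOn f (Set.Ici N) := by
  obtain ⟨s, hs⟩ := hpm
  obtain ⟨N, haN, hN⟩ := s.exists_forall_lt_real a
  have hs' : ∀ b, N < b → MonotoneOn f (Set.Ioo N b) ∨ AntitoneOn f (Set.Ioo N b) :=
    fun b hb => hs N b hb fun c hc hcI => lt_asymm hcI.1 (hN c hc)
  suffices h : AntitoneOn f (Set.Ioi N) from
    ⟨N + 1, by linarith, h.mono fun x hx => (lt_add_one N).trans_le hx⟩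
  by_cases hall : ∀ b, N < b → AntitoneOn f (Set.Ioo N b)
  · intro x hx y hy hxy
    have hy' : N < y := hy
    exact hall (y + 1) (by linarith) ⟨hx, by linarith⟩ ⟨hy, by linarith⟩ hxy
  · push Not at hall
    obtain ⟨b, hb, hnot⟩ := hall
    have hm : MonotoneOn f (Set.Ioi N) := by
      intro x hx y hy hxy
      have hle : b ≤ max b (y + 1) := le_max_left _ _
      have hlt : y < max b (y + 1) := (lt_add_one y).trans_le (le_max_right _ _)
      refine (hs' (max b (y + 1)) (hb.trans_le hle)).resolve_right (fun ha => hnot ?_)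
        ⟨hx, hxy.trans_lt hlt⟩ ⟨hy, hlt⟩ hxy
      exact ha.mono (Set.Ioo_subset_Ioo_right hle)
    intro x hx y hy _
    rw [eq_zero_of_monotoneOn_Ioi hi h0 hm hx, eq_zero_of_monotoneOn_Ioi hi h0 hm hy]

lemma AntitoneOn.exists_lt_of_integrable {f : ℝ → ℝ} (hi : Integrable f) (h0 : ∀ x, 0 ≤ f x)
    {E : ℝ} (ha : AntitoneOn f (Set.Ici E)) (hE : 0 < f E) : ∃ b, E < b ∧ f b < f E := by
  by_contra! h
  have hm : MonotoneOn f (Set.Ioi E) := fun x hx y hy _ =>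
    (ha (Set.mem_Ici.2 le_rfl) (Set.Ioi_subset_Ici_self hx) (le_of_lt hx)).trans (h y hy)
  have h1 := eq_zero_of_monotoneOn_Ioi hi h0 hm (lt_add_one E)
  linarith [h (E + 1) (lt_add_one E)]

/-- Beyond a point of positive density, the density is continuous up to some `E` and
nonincreasing afterwards. -/
lemma IsNoiseDensity.exists_continuousOn_antitoneOn {f : ℝ → ℝ} {xl xu : EReal}
    (hf : IsNoiseDensity f xl xu) (hpm : PiecewiseMonotone f) {xm : ℝ} (hxm : 0 < f xm) :
    ∃ E, xm ≤ E ∧ ContinuousOn f (Set.Icc xm E) ∧ AntitoneOn f (Set.Ici E) := by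
  have hi := hf.integrable
  obtain ⟨hlu, h0, -, -, hout, hc⟩ := hf
  have hl : xl ≤ xm := le_of_not_gt fun h => hxm.ne' (hout xm (Or.inl h))
  have hu : (xm : EReal) ≤ xu := le_of_not_gt fun h => hxm.ne' (hout xm (Or.inr h))
  by_cases htop : xu = ⊤
  · obtain ⟨N, hN, hanti⟩ := hpm.exists_antitoneOn_Ici hi h0 xm
    refine ⟨N, hN, hc.mono fun x hx => ⟨hl.trans (EReal.coe_le_coe_iff.2 hx.1), ?_⟩, hanti⟩
    rw [htop]; exact le_top
  · have hbot : xu ≠ ⊥ := ne_bot_of_gt hlu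
    lift xu to ℝ using ⟨htop, hbot⟩
    refine ⟨xu, EReal.coe_le_coe_iff.1 hu, hc.mono fun x hx =>
      ⟨hl.trans (EReal.coe_le_coe_iff.2 hx.1), EReal.coe_le_coe_iff.2 hx.2⟩, ?_⟩
    intro x hx y hy hxy
    rcases hxy.eq_or_lt with rfl | h
    · exact le_rfl
    · rw [hout y (Or.inr (EReal.coe_lt_coe_iff.2 (lt_of_le_of_lt hx h)))]
      exact h0 x

lemma Fcdf_pos {f : ℝ → ℝ} (hi : Integrable f) (h0 : ∀ x, 0 ≤ f x) {a x : ℝ} (hax : a < x)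
    (hc : ContinuousOn f (Set.Icc a x)) (ha : 0 < f a) : 0 < Fcdf f x := by
  have h1 : 0 < ∫ u in a..x, f u := intervalIntegral.integral_pos hax hc (fun u _ => h0 u)
    ⟨a, ⟨le_rfl, hax.le⟩, ha⟩
  have h2 : 0 ≤ Fcdf f a := setIntegral_nonneg measurableSet_Iic fun y _ => h0 y
  rw [Fcdf_eq_add hi a x]
  linarith

/-- For any prize schedule, the marginal benefit of effort is maximized by a
threshold located at a mode of the noise density weakly above its (largest) global mode. -/
theorem stmt0 (n : ℕ) (hn : 2 ≤ n) (f : ℝ → ℝ) (xl xu : EReal)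
    (hf : IsNoiseDensity f xl xu) (hpm : PiecewiseMonotone f)
    (xm : ℝ) (hmax : ∀ x, f x ≤ f xm) (hlargest : ∀ x, f x = f xm → x ≤ xm)
    (hmode : IsMode f xm) :
    ∀ v : ℕ → ℝ, IsPrizeSchedule n v →
      ∃ m : ℝ, xm ≤ m ∧ IsMode f m ∧ ∀ t : ℝ, gmb f n v t ≤ gmb f n v m := by
  intro v hv
  have hi := hf.integrable
  have h0 := hf.2.1
  have h1 := hf.2.2.2.1
  have hmem := Fcdf_mem_Icc hi h0 h1
  have hxm : 0 < f xm := by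
    obtain ⟨a, -, -, -, -, -, ha, -⟩ := hmode
    exact (h0 a).trans_lt ha
  obtain ⟨E, hE, hfc, hanti⟩ := hf.exists_continuousOn_antitoneOn hpm hxm
  have hh := integrable_comp_Fcdf_mul hi h0 h1 (continuous_prizePdf n v)
  have hfh := hf.integrable_mul hh
  have hFTC := hf.integral_comp_Fcdf_mul (hasDerivAt_prizeCdf n v) (continuous_prizePdf n v)
  have hh0 : ∀ x, 0 ≤ prizePdf n v (Fcdf f x) * f x := fun x =>
    mul_nonneg (prizePdf_nonneg hv (hmem x)) (h0 x)
  have hΦc : Continuous (prizeCdf n v) :=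
    continuous_iff_continuousAt.2 fun y => (hasDerivAt_prizeCdf n v y).continuousAt
  rw [hf.gmb_eq n v]
  refine exists_mode_isMax (G := fun x => prizeCdf n v (Fcdf f x)) hE hpm h0 hfc hanti
    (hanti.exists_lt_of_integrable hi h0) hmax hlargest hmode
    (continuousOn_stieltjesBenefit hfh hfc (hΦc.comp (continuous_Fcdf hi)).continuousOn)
    (fun x => ?_) (fun x hx => ?_)
    (fun s t hst hle => stieltjesBenefit_le_of_le_right hh hfh hFTC hh0 hst hle)
    (fun s t hst hle => stieltjesBenefit_le_of_le_left hh hfh hFTC hh0 hst hle)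
  · exact (mul_nonneg (pow_nonneg (hmem x).1 _) hv.first_pos.le).trans
      (pow_mul_le_prizeCdf hv (hmem x))
  · have hF := Fcdf_pos hi h0 hx.1 (hfc.mono (Set.Icc_subset_Icc_right hx.2)) hxm
    exact (mul_pos (pow_pos hF _) hv.first_pos).trans_le (pow_mul_le_prizeCdf hv (hmem x))
end

section
/- Let n ≥ 2 and b_1, …, b_n ≥ 0. Then for every prize schedule v ∈ 𝒱, ∑_{r=1}^n b_r·(v_r − v_{r+1}) ≤ max_{1 ≤ r ≤ n} b_r/r. Moreover, if r* attains max_{1 ≤ r ≤ n} b_r/r, then the prize schedule with v_1 = … = v_{r*} = 1/r* and v_{r*+1} = … = v_n = 0 achieves this bound with equality. -/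
open MeasureTheory

/-- Abel summation for the gaps of a finite sequence. -/
theorem sum_natCast_mul_sub_succ (v : ℕ → ℝ) (n : ℕ) :
    ∑ r ∈ Finset.Icc 1 n, (r : ℝ) * (v r - v (r + 1)) =
      ∑ r ∈ Finset.Icc 1 n, v r - n * v (n + 1) := by
  induction n with
  | zero => simp
  | succ k ih =>
    rw [Finset.sum_Icc_succ_top (by omega), Finset.sum_Icc_succ_top (by omega), ih]
    push_cast
    ring

/-- For nonnegative coefficients `b_1, …, b_n`, every prize schedule satisfies
`∑ b_r (v_r - v_{r+1}) ≤ max_r b_r / r`, and the schedule awarding `r*` equal prizes `1/r*`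
(where `r*` attains the maximum of `b_r / r`) achieves the bound with equality. -/
theorem stmt5 (n : ℕ) (hn : 2 ≤ n) (b : ℕ → ℝ) (hb : ∀ r ∈ Finset.Icc 1 n, 0 ≤ b r)
    (rs : ℕ) (hrs : rs ∈ Finset.Icc 1 n)
    (hmax : ∀ r ∈ Finset.Icc 1 n, b r / (r : ℝ) ≤ b rs / (rs : ℝ)) :
    (∀ v : ℕ → ℝ, IsPrizeSchedule n v →
        ∑ r ∈ Finset.Icc 1 n, b r * (v r - v (r + 1)) ≤ b rs / (rs : ℝ)) ∧
      IsPrizeSchedule n (fun r => if r ≤ rs then (1 : ℝ) / (rs : ℝ) else 0) ∧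
      ∑ r ∈ Finset.Icc 1 n,
          b r * ((if r ≤ rs then (1 : ℝ) / (rs : ℝ) else 0) -
            (if r + 1 ≤ rs then (1 : ℝ) / (rs : ℝ) else 0)) = b rs / (rs : ℝ) := by
  obtain ⟨hrs1, hrsn⟩ := Finset.mem_Icc.mp hrs
  have hrs0 : (rs : ℝ) ≠ 0 := by positivity
  refine ⟨fun v ⟨hnonneg, hanti, hsum, hlast⟩ => ?_, ⟨fun r _ => ?_, fun r _ _ => ?_, ?_, ?_⟩, ?_⟩
  · calc ∑ r ∈ Finset.Icc 1 n, b r * (v r - v (r + 1))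
        ≤ ∑ r ∈ Finset.Icc 1 n, b rs / rs * (r * (v r - v (r + 1))) := by
          refine Finset.sum_le_sum fun r hr => ?_
          obtain ⟨hr1, hrn⟩ := Finset.mem_Icc.mp hr
          have hgap : 0 ≤ v r - v (r + 1) := by
            rcases hrn.lt_or_eq with h | rfl
            · exact sub_nonneg.mpr (hanti r hr1 h)
            · simpa [hlast] using hnonneg r hr
          have hbr : b r ≤ b rs / rs * r :=
            (div_le_iff₀ (by exact_mod_cast hr1)).mp (hmax r hr)
          rw [← mul_assoc]
          exact mul_le_mul_of_nonneg_right hbr hgap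
      _ = b rs / rs := by
          rw [← Finset.mul_sum, sum_natCast_mul_sub_succ, hsum, hlast]
          ring
  · dsimp only
    split_ifs <;> positivity
  · dsimp only
    split_ifs
    · exact le_rfl
    · omega
    · positivity
    · exact le_rfl
  · have hfilter : (Finset.Icc 1 n).filter (· ≤ rs) = Finset.Icc 1 rs := by
      ext r
      simp only [Finset.mem_filter, Finset.mem_Icc]
      omega
    rw [← Finset.sum_filter, hfilter]
    simp [hrs0]
  · exact if_neg (by omega)
  · rw [Finset.sum_eq_single_of_mem rs hrs]
    · simp [div_eq_mul_inv]
    · intro r _ hne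
      have hiff : r + 1 ≤ rs ↔ r ≤ rs := by omega
      simp [hiff]
end
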